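/- arXiv:1907.11016 — 2 statements merged into one kernel-verified Lean document; each statement's English description precedes it below -/
import Mathlib

section
/- A nontrivial zero of a vector-valued cubic map whose associated quadratic forms have no common isotropic vector is a regular zero: Let P : ℝ^N → ℝ^n be a cubic map (homogeneous polynomial map of degree 3) with associated symmetric trilinear map T. If N ≥ n+1, then P has a nontrivial zero v, and if moreover for every nonzero linear functional λ : ℝ^n → ℝ the quadratic forms x ↦ λ(T(e_i, x, x)), i = 1,…,N, have no common nonzero isotropic vector, then P has a regular zero, i.e., a point v with P(v) = 0 and x ↦ T(v,v,x) surjective onto ℝ^n. -/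
open Module in
/-- For all but finitely many `δ`, the perturbed family `a + δ • b` still spans the span of `a`,
provided the members of `b` lie in that span. -/
lemma finite_setOf_not_mem_span_add_smul {ι V : Type*} [Finite ι] [AddCommGroup V] [Module ℝ V]
    (a b : ι → V) (hb : ∀ k, b k ∈ Submodule.span ℝ (Set.range a)) :
    {δ : ℝ | ¬ ∀ k, a k ∈ Submodule.span ℝ (Set.range fun k => a k + δ • b k)}.Finite := by
  classical
  have := Fintype.ofFinite ι
  simp only [Submodule.mem_span_range_iff_exists_fun] at hb
  choose c hc using hb
  let M : Matrix ι ι ℝ := Matrix.of c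
  refine ((M.finite_spectrum).image fun r => -r⁻¹).subset ?_
  intro δ hδ
  by_cases h0 : δ = 0
  · subst h0
    refine absurd (fun k => Submodule.subset_span (Set.mem_range.2 ⟨k, ?_⟩)) hδ
    simp
  refine ⟨-δ⁻¹, ?_, by simp⟩
  rw [spectrum.mem_iff]
  intro hu
  refine hδ fun k => ?_
  have hu' : IsUnit (1 + δ • M) := by
    have := hu.smul (Units.mk0 (-δ) (neg_ne_zero.2 h0))
    convert this using 1
    simp only [Units.smul_def, Units.val_mk0, smul_sub, Algebra.algebraMap_eq_smul_one, smul_smul]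
    simp [h0]
  obtain ⟨A, hA⟩ := hu'.exists_left_inv
  rw [Submodule.mem_span_range_iff_exists_fun]
  refine ⟨A k, ?_⟩
  have h1 : ∀ l, a l + δ • b l = ∑ m, (1 + δ • M) l m • a m := by
    intro l
    simp [Matrix.add_apply, add_smul, Finset.sum_add_distrib, Matrix.one_apply, mul_smul,
      ← Finset.smul_sum, M, hc]
  simp_rw [h1, Finset.smul_sum, smul_smul]
  rw [Finset.sum_comm]
  simp_rw [← Finset.sum_smul, ← Matrix.mul_apply, hA]
  simp [Matrix.one_apply]

lemma LinearIndependent.of_mem_span_range {ι V : Type*} [Finite ι] [AddCommGroup V] [Module ℝ V]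
    {a g : ι → V} (ha : LinearIndependent ℝ a)
    (h : ∀ k, a k ∈ Submodule.span ℝ (Set.range g)) : LinearIndependent ℝ g := by
  have := Fintype.ofFinite ι
  rw [linearIndependent_iff_card_le_finrank_span] at ha ⊢
  refine ha.trans ?_
  have : FiniteDimensional ℝ (Submodule.span ℝ (Set.range g)) :=
    FiniteDimensional.span_of_finite ℝ (Set.finite_range g)
  refine Submodule.finrank_mono (Submodule.span_le.2 ?_)
  rintro _ ⟨k, rfl⟩
  exact h k

open Module in
/-- If a commutative real algebra acts on an odd-dimensional real vector space, then it has a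
maximal ideal of odd codimension. -/
lemma exists_isMaximal_odd_finrank_quotient {A : Type*} [CommRing A] [Algebra ℝ A] (d : ℕ) :
    ∀ (M : Type*) [AddCommGroup M] [Module ℝ M] [Module A M] [IsScalarTower ℝ A M]
      [FiniteDimensional ℝ M], finrank ℝ M = d → Odd d →
      ∃ m : Ideal A, m.IsMaximal ∧ Odd (finrank ℝ (A ⧸ m)) := by
  induction d using Nat.strong_induction_on with
  | _ d ih =>
  intro M _ _ _ _ _ hd hodd
  have : Nontrivial M := nontrivial_of_finrank_pos (R := ℝ) (hd ▸ hodd.pos)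
  by_cases hs : IsSimpleModule A M
  · obtain ⟨m, hm, ⟨e⟩⟩ := isSimpleModule_iff_quot_maximal.mp hs
    exact ⟨m, hm, by rw [← (e.restrictScalars ℝ).finrank_eq, hd]; exact hodd⟩
  · have : ∃ N : Submodule A M, N ≠ ⊥ ∧ N ≠ ⊤ := by
      by_contra! h
      exact hs ((isSimpleModule_iff A M).2
        { eq_bot_or_eq_top := fun N => or_iff_not_imp_left.2 (h N) })
    obtain ⟨N, hN0, hN1⟩ := this
    have hsum : finrank ℝ (M ⧸ N) + finrank ℝ N = d :=
      hd ▸ (N.restrictScalars ℝ).finrank_quotient_add_finrank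
    have : Nontrivial N := (Submodule.nontrivial_iff_ne_bot).2 hN0
    have : Nontrivial (M ⧸ N) := Submodule.Quotient.nontrivial_iff.2 hN1
    have : FiniteDimensional ℝ N := inferInstanceAs (FiniteDimensional ℝ (N.restrictScalars ℝ))
    have : FiniteDimensional ℝ (M ⧸ N) :=
      inferInstanceAs (FiniteDimensional ℝ (M ⧸ N.restrictScalars ℝ))
    have h1 : 0 < finrank ℝ N := finrank_pos
    have h2 : 0 < finrank ℝ (M ⧸ N) := finrank_pos
    by_cases ho : Odd (finrank ℝ N)
    · exact ih _ (by omega) N rfl ho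
    · refine ih _ (by omega) (M ⧸ N) rfl ?_
      rw [Nat.odd_iff] at *
      omega

open Module in
/-- A commutative real algebra of odd dimension has a real point. -/
lemma nonempty_algHom_real_of_odd_finrank {A : Type*} [CommRing A] [Algebra ℝ A]
    (h : Odd (finrank ℝ A)) : Nonempty (A →ₐ[ℝ] ℝ) := by
  have : FiniteDimensional ℝ A := FiniteDimensional.of_finrank_pos h.pos
  obtain ⟨m, hm, hodd⟩ := exists_isMaximal_odd_finrank_quotient (A := A) _ A rfl h
  let : Field (A ⧸ m) := Ideal.Quotient.field m
  rcases Real.nonempty_algEquiv_or (A ⧸ m) with ⟨⟨e⟩⟩ | ⟨⟨e⟩⟩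
  · exact ⟨e.toAlgHom.comp (Ideal.Quotient.mkₐ ℝ m)⟩
  · rw [e.toLinearEquiv.finrank_eq, Complex.finrank_real_complex] at hodd
    exact absurd hodd (by decide)

open MvPolynomial

/-- If `c` is divisible by some `X i ^ 3`, trade this factor for `h i`; otherwise return `0`. -/
noncomputable def cubeReduct {σ : Type*} (h : σ → MvPolynomial σ ℝ) (c : σ →₀ ℕ) :
    MvPolynomial σ ℝ :=
  open Classical in
  if H : ∃ i, 3 ≤ c i then monomial (c - Finsupp.single H.choose 3) 1 * h H.choose else 0

lemma MvPolynomial.mem_span_monomial_of_totalDegree_le {σ : Type*} {D : ℕ} {p : MvPolynomial σ ℝ}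
    (hp : p.totalDegree ≤ D) :
    p ∈ Submodule.span ℝ (Set.range fun c : {c : σ →₀ ℕ | c.degree ≤ D} =>
      (monomial c.1 1 : MvPolynomial σ ℝ)) := by
  rw [p.as_sum]
  refine Submodule.sum_mem _ fun c hc => ?_
  rw [← mul_one (coeff c p), ← smul_eq_mul, ← smul_monomial]
  refine Submodule.smul_mem _ _ (Submodule.subset_span ⟨⟨c, ?_⟩, rfl⟩)
  exact (le_totalDegree hc).trans hp

lemma Finsupp.sub_single_add_single {σ : Type*} {c : σ →₀ ℕ} {i : σ} {k : ℕ} (h : k ≤ c i) :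
    c - Finsupp.single i k + Finsupp.single i k = c :=
  tsub_add_cancel_of_le (Finsupp.single_le_iff.2 h)

lemma Finsupp.degree_sub_single_add {σ : Type*} {c : σ →₀ ℕ} {i : σ} {k : ℕ} (h : k ≤ c i) :
    (c - Finsupp.single i k).degree + k = c.degree := by
  conv_rhs => rw [← Finsupp.sub_single_add_single h]
  simp

lemma MvPolynomial.totalDegree_monomial_one_mul_le {σ : Type*} {h : MvPolynomial σ ℝ} {k : ℕ}
    (hh : h.totalDegree ≤ k) (c : σ →₀ ℕ) :
    (monomial c 1 * h).totalDegree ≤ c.degree + k :=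
  (totalDegree_mul _ _).trans (add_le_add (totalDegree_monomial_le _ _) hh)

/-- The polynomials obtained from monomials by replacing a divisor `X i ^ 3` with
`X i ^ 3 + δ h i` span all polynomials of bounded degree, for all but finitely many `δ`. -/
lemma finite_setOf_not_monomial_mem_span_cubeReduct {σ : Type*} [Finite σ] (h : σ → MvPolynomial σ ℝ)
    (hh : ∀ i, (h i).totalDegree ≤ 3) (D : ℕ) :
    {δ : ℝ | ¬ ∀ c : {c : σ →₀ ℕ | c.degree ≤ D}, (monomial c.1 1 : MvPolynomial σ ℝ) ∈
      Submodule.span ℝ (Set.range fun c : {c : σ →₀ ℕ | c.degree ≤ D} =>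
        (monomial c.1 1 : MvPolynomial σ ℝ) + δ • cubeReduct h c)}.Finite := by
  have : Finite {c : σ →₀ ℕ | c.degree ≤ D} := Finsupp.finite_of_degree_le D
  refine finite_setOf_not_mem_span_add_smul
    (fun c : {c : σ →₀ ℕ | c.degree ≤ D} => (monomial c.1 1 : MvPolynomial σ ℝ))
    (fun c => cubeReduct h c.1) fun ⟨c, hc⟩ => ?_
  refine mem_span_monomial_of_totalDegree_le ?_
  dsimp only
  unfold cubeReduct
  split_ifs with H
  · refine (totalDegree_monomial_one_mul_le (hh _) _).trans ?_
    rw [Finsupp.degree_sub_single_add H.choose_spec]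
    exact hc
  · simp

lemma monomial_eq_mul_X_cube {σ : Type*} {c : σ →₀ ℕ} {i : σ} (h : 3 ≤ c i) :
    (monomial c 1 : MvPolynomial σ ℝ) = monomial (c - Finsupp.single i 3) 1 * X i ^ 3 := by
  rw [X_pow_eq_monomial, monomial_mul, Finsupp.sub_single_add_single h, one_mul]

/-- For all but finitely many `δ`, all multiples of `X i ^ 3 + δ h i` by monomials of bounded degree
are linear combinations of the reducts of monomials divisible by some cube. -/
lemma finite_setOf_not_mul_mem_span_cubeReduct {σ : Type*} [Finite σ] (h : σ → MvPolynomial σ ℝ)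
    (hh : ∀ i, (h i).totalDegree ≤ 3) (D : ℕ) :
    {δ : ℝ | ¬ ∀ (c : σ →₀ ℕ) (i : σ), c.degree + 3 ≤ D →
      monomial c 1 * (X i ^ 3 + δ • h i) ∈
      Submodule.span ℝ ((fun c : σ →₀ ℕ => (monomial c 1 : MvPolynomial σ ℝ) +
        δ • cubeReduct h c) '' {c | ∃ i, 3 ≤ c i})}.Finite := by
  classical
  have := Fintype.ofFinite σ
  let ι := {p : (σ →₀ ℕ) × σ // p.1.degree + 3 ≤ D}
  have : Finite ι := by
    have : Finite {c : σ →₀ ℕ | c.degree ≤ D} := Finsupp.finite_of_degree_le D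
    refine Finite.of_injective (β := {c : σ →₀ ℕ | c.degree ≤ D} × σ)
      (fun p => (⟨p.1.1, by have := p.2; simp; omega⟩, p.1.2)) ?_
    rintro ⟨⟨a, b⟩, h⟩ ⟨⟨c, d⟩, h'⟩ hp
    exact Subtype.ext (by simpa using hp)
  have hex : ∀ p : (σ →₀ ℕ) × σ, ∃ i, 3 ≤ (p.1 + Finsupp.single p.2 3 : σ →₀ ℕ) i := fun p => ⟨p.2, by simp⟩
  let j : (σ →₀ ℕ) × σ → σ := fun p => (hex p).choose
  have hj : ∀ p, 3 ≤ (p.1 + Finsupp.single p.2 3 : σ →₀ ℕ) (j p) := fun p => (hex p).choose_spec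
  have hj' : ∀ p, j p ≠ p.2 → 3 ≤ p.1 (j p) := fun p hp => by
    simpa [Finsupp.single_apply, hp.symm] using hj p
  let e : (σ →₀ ℕ) × σ → (σ → MvPolynomial σ ℝ) := fun p => Pi.single p.2 (monomial p.1 1)
  let r : (σ →₀ ℕ) × σ → (σ →₀ ℕ) × σ := fun p =>
    (p.1 + Finsupp.single p.2 3 - Finsupp.single (j p) 3, j p)
  have hrdeg : ∀ p, (r p).1.degree = p.1.degree := fun p => by
    have := Finsupp.degree_sub_single_add (hj p)
    simp only [map_add, Finsupp.degree_single] at this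
    simp only [r]
    omega
  have hrr : ∀ p, (r p).1 + Finsupp.single (r p).2 3 = p.1 + Finsupp.single p.2 3 := fun p =>
    Finsupp.sub_single_add_single (hj p)
  have hjr : ∀ p, j (r p) = j p := fun p => by
    simp only [j, hrr p]
  let a : ι → (σ → MvPolynomial σ ℝ) := fun p => if j p.1 = p.1.2 then e p.1 else e p.1 - e (r p.1)
  let s : (σ →₀ ℕ) × σ → (σ →₀ ℕ) := fun p => p.1 - Finsupp.single (j p) 3
  let b : ι → (σ → MvPolynomial σ ℝ) := fun p => if j p.1 = p.1.2 then 0 else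
    Pi.single p.1.2 (monomial (s p.1) 1 * h (j p.1)) -
      Pi.single (j p.1) (monomial (s p.1) 1 * h p.1.2)
  have hae : ∀ p : ι, e p.1 ∈ Submodule.span ℝ (Set.range a) := by
    have h1 : ∀ p : ι, j p.1 = p.1.2 → e p.1 ∈ Submodule.span ℝ (Set.range a) := fun p hp =>
      Submodule.subset_span ⟨p, by simp [a, hp]⟩
    intro p
    by_cases hp : j p.1 = p.1.2
    · exact h1 p hp
    · have h2 : e p.1 = a p + e (r p.1) := by simp [a, hp]
      rw [h2]
      refine add_mem (Submodule.subset_span ⟨p, rfl⟩) (h1 ⟨r p.1, ?_⟩ (hjr p.1))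
      rw [hrdeg]
      exact p.2
  have hsingle : ∀ (i : σ) (p : MvPolynomial σ ℝ), p.totalDegree + 3 ≤ D →
      Pi.single i p ∈ Submodule.span ℝ (Set.range a) := by
    intro i p hp
    have h1 : p ∈ (Submodule.span ℝ (Set.range a)).comap
        (LinearMap.single ℝ (fun _ : σ => MvPolynomial σ ℝ) i) := by
      refine (Submodule.span_le.2 ?_) (mem_span_monomial_of_totalDegree_le le_rfl)
      rintro _ ⟨⟨c, hc⟩, rfl⟩
      have hc : c.degree ≤ p.totalDegree := hc
      exact hae ⟨(c, i), by dsimp only; omega⟩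
    exact h1
  have hb : ∀ p, b p ∈ Submodule.span ℝ (Set.range a) := by
    rintro ⟨p, hpD⟩
    simp only [b]
    split_ifs with hp
    · exact zero_mem _
    · have hs := Finsupp.degree_sub_single_add (hj' p hp)
      refine sub_mem (hsingle _ _ ?_) (hsingle _ _ ?_)
      all_goals
        refine (Nat.add_le_add_right (totalDegree_monomial_one_mul_le (hh _) _) 3).trans ?_
        simp only [s]
        omega
  refine (finite_setOf_not_mem_span_add_smul a b hb).subset ?_
  intro δ hδ hspan
  refine hδ fun c i hci => ?_
  set J := Submodule.span ℝ ((fun c : σ →₀ ℕ => (monomial c 1 : MvPolynomial σ ℝ) +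
        δ • cubeReduct h c) '' {c | ∃ i, 3 ≤ c i})
  let φ : (σ → MvPolynomial σ ℝ) →ₗ[ℝ] MvPolynomial σ ℝ :=
    (Fintype.linearCombination (MvPolynomial σ ℝ)
      (fun i => (X i ^ 3 + δ • h i : MvPolynomial σ ℝ))).restrictScalars ℝ
  have hφ : ∀ i p, φ (Pi.single i p) = p * (X i ^ 3 + δ • h i) := fun i p => by
    simp [φ, Fintype.linearCombination_apply_single]
  have hle : Submodule.span ℝ (Set.range fun k => a k + δ • b k) ≤ J.comap φ := by
    refine Submodule.span_le.2 ?_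
    rintro _ ⟨⟨p, hpD⟩, rfl⟩
    simp only [SetLike.mem_coe, Submodule.mem_comap, a, b]
    by_cases hp : j p = p.2
    · simp only [hp, if_true, smul_zero, add_zero, e, hφ]
      refine Submodule.subset_span ⟨p.1 + Finsupp.single p.2 3, hex p, ?_⟩
      have hp' : (hex p).choose = p.2 := hp
      simp only [cubeReduct, dif_pos (hex p), hp', add_tsub_cancel_right, mul_add,
        X_pow_eq_monomial, monomial_mul, mul_one, mul_smul_comm]
    · simp only [hp, if_false]
      convert J.zero_mem
      simp only [map_add, map_sub, map_smul, e, hφ, r]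
      have e1 := monomial_eq_mul_X_cube (hj' p hp)
      have e2 : (monomial (p.1 + Finsupp.single p.2 3 - Finsupp.single (j p) 3) 1 :
          MvPolynomial σ ℝ) = monomial (s p) 1 * X p.2 ^ 3 := by
        rw [X_pow_eq_monomial, monomial_mul, one_mul,
          tsub_add_eq_add_tsub (Finsupp.single_le_iff.2 (hj' p hp))]
      rw [e1, e2]
      simp only [smul_eq_C_mul, s]
      ring
  have h1 : Submodule.span ℝ (Set.range a) ≤ J.comap φ := by
    refine (Submodule.span_le.2 ?_).trans hle
    rintro _ ⟨k, rfl⟩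
    exact hspan k
  have := h1 (hae ⟨(c, i), hci⟩)
  simpa [e, hφ] using this

lemma odd_natCard_lt_three (σ : Type*) [Finite σ] :
    Odd (Nat.card {c : σ →₀ ℕ | ¬ ∃ i, 3 ≤ c i}) := by
  have := Fintype.ofFinite σ
  have e : {c : σ →₀ ℕ | ¬ ∃ i, 3 ≤ c i} ≃ (σ → {k : ℕ // k < 3}) :=
    (Finsupp.equivFunOnFinite.subtypeEquiv (q := fun f => ∀ i, f i < 3) (by simp)).trans
      (Equiv.subtypePiEquivPi (p := fun _ k => k < 3))
  rw [Nat.card_congr e, Nat.card_fun, Nat.card_congr Fin.equivSubtype.symm, Nat.card_fin]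
  exact Odd.pow (by decide)

lemma LinearIndependent.finrank_quotient_eq_natCard {ι V : Type*} [AddCommGroup V] [Module ℝ V]
    {g : ι → V} (hg : LinearIndependent ℝ g) (hspan : Submodule.span ℝ (Set.range g) = ⊤)
    {s : Set ι} {p : Submodule ℝ V} (hp : p = Submodule.span ℝ (g '' s)) :
    Module.finrank ℝ (V ⧸ p) = Nat.card (sᶜ : Set ι) := by
  have hcompl : IsCompl p (Submodule.span ℝ (g '' sᶜ)) := by
    rw [hp]
    refine ⟨hg.disjoint_span_image disjoint_compl_right, ?_⟩
    rw [codisjoint_iff, ← Submodule.span_union, ← Set.image_union, Set.union_compl_self,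
      Set.image_univ, hspan]
  have h1 : LinearIndependent ℝ (fun c : (sᶜ : Set ι) => g c) :=
    hg.comp _ Subtype.val_injective
  rw [(Submodule.quotientEquivOfIsCompl _ _ hcompl).finrank_eq, Set.image_eq_range,
    Module.finrank_eq_nat_card_basis (Module.Basis.span h1)]

/-- Real affine Bézout theorem for a generic member of a pencil of cubics through the pure cubes. -/
lemma exists_countable_forall_notMem_exists_zero {σ : Type*} [Finite σ] (h : σ → MvPolynomial σ ℝ)
    (hh : ∀ i, (h i).totalDegree ≤ 3) :
    ∃ S : Set ℝ, S.Countable ∧ ∀ δ ∉ S, ∃ x : σ → ℝ, ∀ i, x i ^ 3 + δ * eval x (h i) = 0 := by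
  classical
  have := Fintype.ofFinite σ
  refine ⟨_, (Set.countable_iUnion fun D => (finite_setOf_not_monomial_mem_span_cubeReduct h hh D).countable).union
    (Set.countable_iUnion fun D => (finite_setOf_not_mul_mem_span_cubeReduct h hh D).countable), fun δ hδ => ?_⟩
  simp only [Set.mem_union, Set.mem_iUnion, Set.mem_ofPred_eq, not_or, not_exists, not_not] at hδ
  obtain ⟨hred, hsyz⟩ := hδ
  let g : (σ →₀ ℕ) → MvPolynomial σ ℝ := fun c => monomial c 1 + δ • cubeReduct h c
  let f : σ → MvPolynomial σ ℝ := fun i => X i ^ 3 + δ • h i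
  let s : Set (σ →₀ ℕ) := {c | ∃ i, 3 ≤ c i}
  have hli : LinearIndependent ℝ g := by
    rw [linearIndependent_iff_finset_linearIndependent]
    intro t
    let D := t.sup Finsupp.degree
    have : Finite {c : σ →₀ ℕ | c.degree ≤ D} := Finsupp.finite_of_degree_le D
    have h1 : LinearIndependent ℝ (fun c : {c : σ →₀ ℕ | c.degree ≤ D} => g c) := by
      refine LinearIndependent.of_mem_span_range ?_ (hred D)
      exact (basisMonomials σ ℝ).linearIndependent.comp _ Subtype.val_injective
    exact h1.comp (fun c : t => ⟨c.1, Finset.le_sup (f := Finsupp.degree) c.2⟩)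
      fun a b hab => Subtype.ext (by simpa using hab)
  have hspan : Submodule.span ℝ (Set.range g) = ⊤ := by
    rw [eq_top_iff, ← (basisMonomials σ ℝ).span_eq, Submodule.span_le]
    rintro _ ⟨c, rfl⟩
    refine Submodule.span_mono ?_ (hred c.degree ⟨c, le_refl c.degree⟩)
    rintro _ ⟨k, rfl⟩
    exact ⟨k, rfl⟩
  let I : Ideal (MvPolynomial σ ℝ) := Ideal.span (Set.range f)
  have hI : I.restrictScalars ℝ = Submodule.span ℝ (g '' s) := by
    apply le_antisymm
    · intro p hp
      obtain ⟨q, rfl⟩ := Ideal.mem_span_range_iff_exists_fun.1 hp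
      refine Submodule.sum_mem _ fun i _ => ?_
      rw [(q i).as_sum, Finset.sum_mul]
      refine Submodule.sum_mem _ fun c _ => ?_
      rw [← mul_one (coeff c (q i)), ← smul_eq_mul (coeff c (q i)), ← smul_monomial, smul_mul_assoc]
      exact Submodule.smul_mem _ _ (hsyz _ c i le_rfl)
    · refine Submodule.span_le.2 ?_
      rintro _ ⟨c, hc, rfl⟩
      have h1 : g c = monomial (c - Finsupp.single hc.choose 3) 1 * f hc.choose := by
        simp only [g, f, cubeReduct]
        rw [dif_pos (show ∃ i, 3 ≤ c i from hc), mul_add, ← monomial_eq_mul_X_cube hc.choose_spec, mul_smul_comm]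
      rw [h1]
      exact I.mul_mem_left _ (Ideal.subset_span ⟨_, rfl⟩)
  have hodd : Odd (Module.finrank ℝ (MvPolynomial σ ℝ ⧸ I)) := by
    have h1 := hli.finrank_quotient_eq_natCard hspan hI
    rw [show Module.finrank ℝ (MvPolynomial σ ℝ ⧸ I) = _ from h1]
    exact odd_natCard_lt_three σ
  obtain ⟨ψ⟩ := nonempty_algHom_real_of_odd_finrank hodd
  refine ⟨fun i => ψ (Ideal.Quotient.mkₐ ℝ I (X i)), fun i => ?_⟩
  have h0 : Ideal.Quotient.mkₐ ℝ I (f i) = 0 :=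
    Ideal.Quotient.eq_zero_iff_mem.2 (Ideal.subset_span ⟨i, rfl⟩)
  have hev : ∀ p, ψ (Ideal.Quotient.mkₐ ℝ I p) =
      eval (fun i => ψ (Ideal.Quotient.mkₐ ℝ I (X i))) p := by
    intro p
    rw [← coe_aeval_eq_eval]
    exact DFunLike.congr_fun (algHom_ext (f := ψ.comp (Ideal.Quotient.mkₐ ℝ I))
      (g := aeval (fun i => ψ (Ideal.Quotient.mkₐ ℝ I (X i)))) (by simp)) p
  have := hev (f i)
  rw [h0, map_zero] at this
  simpa [f, smul_eval] using this.symm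

lemma LinearMap.map_sum_smul₃ {ι E F : Type*} [Fintype ι] [AddCommGroup E] [Module ℝ E]
    [AddCommGroup F] [Module ℝ F] (T : E →ₗ[ℝ] E →ₗ[ℝ] E →ₗ[ℝ] F) (x : ι → ℝ) (u : ι → E) :
    T (∑ a, x a • u a) (∑ a, x a • u a) (∑ a, x a • u a) =
      ∑ a, ∑ b, ∑ c, (x a * x b * x c) • T (u a) (u b) (u c) := by
  rw [map_sum T, LinearMap.sum_apply, LinearMap.sum_apply]
  refine Finset.sum_congr rfl fun a _ => ?_
  rw [map_smul T, LinearMap.smul_apply, LinearMap.smul_apply, map_sum (T (u a)), LinearMap.sum_apply,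
    Finset.smul_sum]
  refine Finset.sum_congr rfl fun b _ => ?_
  rw [map_smul (T (u a)), LinearMap.smul_apply, map_sum, Finset.smul_sum, Finset.smul_sum]
  refine Finset.sum_congr rfl fun c _ => ?_
  rw [map_smul, smul_smul, smul_smul]

/-- A system of `n` real cubic forms in at least `n + 1` variables has a nontrivial zero. -/
lemma exists_ne_zero_trilinear_eq_zero {N n : ℕ} (hNn : n + 1 ≤ N)
    (T : (Fin N → ℝ) →ₗ[ℝ] (Fin N → ℝ) →ₗ[ℝ] (Fin N → ℝ) →ₗ[ℝ] (Fin n → ℝ)) :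
    ∃ v : Fin N → ℝ, v ≠ 0 ∧ T v v v = 0 := by
  let u : Fin (n + 1) → (Fin N → ℝ) := fun a => Pi.single (Fin.castLE hNn a) 1
  let L : Fin (n + 1) → MvPolynomial (Fin n) ℝ := Fin.cons 1 X
  have hL : ∀ a, (L a).totalDegree ≤ 1 := by
    intro a
    refine Fin.cases ?_ (fun k => ?_) a <;> simp [L]
  let h : Fin n → MvPolynomial (Fin n) ℝ := fun i =>
    ∑ a, ∑ b, ∑ c, C (T (u a) (u b) (u c) i) * (L a * L b * L c)
  have hh : ∀ i, (h i).totalDegree ≤ 3 := by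
    intro i
    refine totalDegree_finsetSum_le fun a _ => totalDegree_finsetSum_le fun b _ =>
      totalDegree_finsetSum_le fun c _ => ?_
    refine (totalDegree_mul _ _).trans ?_
    have h1 := totalDegree_mul (L a * L b) (L c)
    have h2 := totalDegree_mul (L a) (L b)
    have := hL a
    have := hL b
    have := hL c
    rw [totalDegree_C]
    omega
  let w : (Fin n → ℝ) → (Fin N → ℝ) := fun x => ∑ a, eval x (L a) • u a
  have hw : ∀ x i, T (w x) (w x) (w x) i = eval x (h i) := by
    intro x i
    simp only [w, LinearMap.map_sum_smul₃]
    simp [h, mul_comm]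
  have hwa : ∀ x a, w x (Fin.castLE hNn a) = eval x (L a) := by
    intro x a
    simp [w, u, Finset.sum_apply, Pi.single_apply]
  obtain ⟨S, hS, hz⟩ := exists_countable_forall_notMem_exists_zero h hh
  have hcont : Continuous fun v : Fin N → ℝ => T v v v := by
    have h1 : ∀ v : Fin N → ℝ, T v v v =
        ∑ a, ∑ b, ∑ c, (v a * v b * v c) • T (Pi.single a 1) (Pi.single b 1) (Pi.single c 1) := by
      intro v
      rw [← LinearMap.map_sum_smul₃, ← pi_eq_sum_univ']
    simp_rw [h1]
    fun_prop
  by_contra! hne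
  have happrox : ∀ k : ℝ, 0 < k → ∃ v ∈ Metric.sphere (0 : Fin N → ℝ) 1, ‖T v v v‖ ≤ k⁻¹ := by
    intro k hk
    obtain ⟨δ, hδk, hδ⟩ : ∃ δ, k < δ ∧ δ ∉ S := by
      obtain ⟨δ, hδ, hδk⟩ := (hS.dense_compl ℝ).exists_gt k
      exact ⟨δ, hδk, hδ⟩
    obtain ⟨x, hx⟩ := hz δ hδ
    have hδ0 : 0 < δ := hk.trans hδk
    have hw0 : 0 < ‖w x‖ := by
      refine norm_pos_iff.2 fun h0 => ?_
      have := hwa x 0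
      simp [h0, L] at this
    refine ⟨‖w x‖⁻¹ • w x, by simp [norm_smul, hw0.ne'], ?_⟩
    refine (pi_norm_le_iff_of_nonneg (by positivity)).2 fun i => ?_
    have h1 : |x i| ≤ ‖w x‖ := by
      have h2 := norm_le_pi_norm (w x) (Fin.castLE hNn i.succ)
      simpa [hwa, L] using h2
    have h3 : eval x (h i) = -(δ⁻¹ * x i ^ 3) := by
      have := hx i
      field_simp
      linarith
    simp only [map_smul, LinearMap.smul_apply, Pi.smul_apply, hw, h3, smul_eq_mul, norm_mul,
      norm_inv, norm_neg, norm_pow, Real.norm_eq_abs, abs_of_pos hδ0, abs_of_pos hw0]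
    have h4 : |x i| ^ 3 ≤ ‖w x‖ ^ 3 := by gcongr
    calc ‖w x‖⁻¹ * (‖w x‖⁻¹ * (‖w x‖⁻¹ * (δ⁻¹ * |x i| ^ 3)))
        ≤ ‖w x‖⁻¹ * (‖w x‖⁻¹ * (‖w x‖⁻¹ * (δ⁻¹ * ‖w x‖ ^ 3))) := by gcongr
      _ = δ⁻¹ := by field_simp
      _ ≤ k⁻¹ := by gcongr
  obtain ⟨v₁, hv₁, -⟩ := happrox 1 one_pos
  obtain ⟨v, hv, hmin⟩ := (isCompact_sphere (0 : Fin N → ℝ) 1).exists_isMinOn ⟨v₁, hv₁⟩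
    hcont.norm.continuousOn
  have hpos : 0 < ‖T v v v‖ := norm_pos_iff.2 (hne v (by rintro rfl; simp at hv))
  obtain ⟨v₂, hv₂, hle⟩ := happrox (2 * ‖T v v v‖⁻¹) (by positivity)
  have h1 : ‖T v v v‖ ≤ ‖T v₂ v₂ v₂‖ := hmin hv₂
  rw [mul_inv, inv_inv] at hle
  linarith

/-- A nontrivial zero of a vector-valued cubic map whose associated
quadratic forms have no common isotropic vector is a regular zero. -/
theorem cubic_map_regular_zero (N n : ℕ) (hNn : N ≥ n + 1)
    (P : (Fin N → ℝ) → (Fin n → ℝ))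
    (T : (Fin N → ℝ) →ₗ[ℝ] (Fin N → ℝ) →ₗ[ℝ] (Fin N → ℝ) →ₗ[ℝ] (Fin n → ℝ))
    (hsym : ∀ x y z, T x y z = T y x z ∧ T x y z = T x z y)
    (hP : ∀ x, P x = T x x x) :
    (∃ v : Fin N → ℝ, v ≠ 0 ∧ P v = 0) ∧
    ((∀ lam : (Fin n → ℝ) →ₗ[ℝ] ℝ, lam ≠ 0 →
        ∀ x : Fin N → ℝ, x ≠ 0 → ∃ i : Fin N, lam (T (Pi.single i 1) x x) ≠ 0) →
      ∃ v : Fin N → ℝ, v ≠ 0 ∧ P v = 0 ∧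
        Function.Surjective (fun x : Fin N → ℝ => T v v x)) := by
  simp only [hP]
  obtain ⟨v, hv0, hv⟩ := exists_ne_zero_trilinear_eq_zero hNn T
  refine ⟨⟨v, hv0, hv⟩, fun hiso => ⟨v, hv0, hv, ?_⟩⟩
  change Function.Surjective (T v v)
  rw [← LinearMap.range_eq_top]
  by_contra hr
  obtain ⟨lam, hlam, hker⟩ := Submodule.exists_le_ker_of_lt_top _ (lt_top_iff_ne_top.2 hr)
  obtain ⟨i, hi⟩ := hiso lam hlam v hv0
  refine hi ?_
  rw [(hsym _ _ _).1, (hsym _ _ _).2]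
  exact hker ⟨_, rfl⟩
end

section
/- For the sub-Riemannian structure on ℝ³ with orthonormal frame f₁ = ∂/∂x₁, f₂ = (1−x₁)∂/∂x₂ + x₁^p ∂/∂x₃ and p ≥ 2 an even integer, set t₀ = 2/(p+1). If 0 < τ < t₀ and η : [0,τ] → ℝ³ is a horizontal curve parameterized by arc-length with η(0) = (0,a,0) and η₁ vanishing at both endpoints, with controls u₁, u₂ satisfying ∫₀^τ u₁ dt = 0 and ∫₀^τ u₂ η₁^p dt = 0, then ∫₀^τ u₂ (1 − η₁) dt ≤ τ, with equality if and only if u₁ = 0 and u₂ = 1 a.e. -/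
open MeasureTheory

/-- A `1`-Lipschitz function vanishing at both ends of `[0, τ]` dominates a tent of height `|f c|`
around any point `c`. -/
theorem two_mul_abs_pow_div_le_integral_abs_pow (p : ℕ) {τ c : ℝ} {f : ℝ → ℝ}
    (hf : ∀ s ∈ Set.Icc 0 τ, ∀ t ∈ Set.Icc 0 τ, |f t - f s| ≤ |t - s|)
    (hcont : ContinuousOn f (Set.Icc 0 τ)) (h0 : f 0 = 0) (hτ : f τ = 0)
    (hc : c ∈ Set.Icc 0 τ) :
    2 * |f c| ^ (p + 1) / ((p : ℝ) + 1) ≤ ∫ t in (0:ℝ)..τ, |f t| ^ p := by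
  obtain ⟨hc0, hcτ⟩ := hc
  have hτ0 : 0 ≤ τ := hc0.trans hcτ
  set b := |f c| with hb
  have hb0 : 0 ≤ b := abs_nonneg _
  have hbc : b ≤ c := by
    simpa [h0, abs_of_nonneg hc0] using hf 0 ⟨le_rfl, hτ0⟩ c ⟨hc0, hcτ⟩
  have hbτ : b ≤ τ - c := by
    have := hf τ ⟨hτ0, le_rfl⟩ c ⟨hc0, hcτ⟩
    rwa [hτ, sub_zero, abs_sub_comm c, abs_of_nonneg (sub_nonneg.2 hcτ)] at this
  have hint : ∀ r s : ℝ, 0 ≤ r → r ≤ s → s ≤ τ →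
      IntervalIntegrable (fun t => |f t| ^ p) volume r s := fun r s hr hrs hs =>
    ((hcont.abs.pow p).mono (Set.Icc_subset_Icc hr hs)).intervalIntegrable_of_Icc hrs
  have hmono : ∫ t in (c - b)..(c + b), |f t| ^ p ≤ ∫ t in (0:ℝ)..τ, |f t| ^ p :=
    intervalIntegral.integral_mono_interval (by linarith) (by linarith) (by linarith)
      (Filter.Eventually.of_forall fun t => by positivity) (hint 0 τ le_rfl hτ0 le_rfl)
  rw [← intervalIntegral.integral_add_adjacent_intervals
    (hint (c - b) c (by linarith) (by linarith) hcτ)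
    (hint c (c + b) hc0 (by linarith) (by linarith))] at hmono
  have hdist : ∀ t ∈ Set.Icc 0 τ, b - |t - c| ≤ |f t| := fun t ht => by
    have h1 := hf t ht c ⟨hc0, hcτ⟩
    have h2 := abs_sub_abs_le_abs_sub (f c) (f t)
    rw [abs_sub_comm c] at h1
    linarith
  have hleft : b ^ (p + 1) / ((p : ℝ) + 1) ≤ ∫ t in (c - b)..c, |f t| ^ p := by
    have hval : ∫ t in (c - b)..c, (t - (c - b)) ^ p = b ^ (p + 1) / ((p : ℝ) + 1) := by
      rw [intervalIntegral.integral_comp_sub_right (fun t => t ^ p), integral_pow]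
      simp
    rw [← hval]
    refine intervalIntegral.integral_mono_on (by linarith)
      (Continuous.intervalIntegrable (by fun_prop) _ _)
      (hint _ _ (by linarith) (by linarith) hcτ) fun t ht => ?_
    have h := hdist t ⟨by linarith [ht.1], by linarith [ht.2]⟩
    rw [abs_of_nonpos (by linarith [ht.2])] at h
    exact pow_le_pow_left₀ (by linarith [ht.1]) (by linarith) p
  have hright : b ^ (p + 1) / ((p : ℝ) + 1) ≤ ∫ t in c..(c + b), |f t| ^ p := by
    have hval : ∫ t in c..(c + b), (c + b - t) ^ p = b ^ (p + 1) / ((p : ℝ) + 1) := by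
      rw [intervalIntegral.integral_comp_sub_left (fun t => t ^ p), integral_pow]
      simp
    rw [← hval]
    refine intervalIntegral.integral_mono_on (by linarith)
      (Continuous.intervalIntegrable (by fun_prop) _ _)
      (hint _ _ hc0 (by linarith) (by linarith)) fun t ht => ?_
    have h := hdist t ⟨by linarith [ht.1], by linarith [ht.2]⟩
    rw [abs_of_nonneg (by linarith [ht.1])] at h
    exact pow_le_pow_left₀ (by linarith [ht.2]) (by linarith) p
  calc 2 * b ^ (p + 1) / ((p : ℝ) + 1)
      = b ^ (p + 1) / ((p : ℝ) + 1) + b ^ (p + 1) / ((p : ℝ) + 1) := by ring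
    _ ≤ _ := (add_le_add hleft hright).trans hmono

/-- The primitive of a function bounded by `1` almost everywhere on `[0, τ]` is `1`-Lipschitz. -/
theorem abs_primitive_sub_le {τ : ℝ} (hτ : 0 ≤ τ) {u : ℝ → ℝ}
    (hu : IntervalIntegrable u volume 0 τ)
    (hbound : ∀ᵐ t ∂volume, t ∈ Set.Icc 0 τ → |u t| ≤ 1)
    {s t : ℝ} (hs : s ∈ Set.Icc 0 τ) (ht : t ∈ Set.Icc 0 τ) :
    |(∫ r in (0:ℝ)..t, u r) - ∫ r in (0:ℝ)..s, u r| ≤ |t - s| := by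
  have hsub : ∀ r ∈ Set.Icc 0 τ, IntervalIntegrable u volume 0 r := fun r hr =>
    hu.mono_set (by rw [Set.uIcc_of_le hr.1, Set.uIcc_of_le hτ]; exact Set.Icc_subset_Icc_right hr.2)
  rw [intervalIntegral.integral_interval_sub_left (hsub t ht) (hsub s hs)]
  have := intervalIntegral.norm_integral_le_of_norm_le_const_ae (a := s) (b := t) (C := 1) (f := u)
    (by
      filter_upwards [hbound] with r hr hmem
      have h := Set.uIoc_subset_uIcc hmem
      exact hr (Set.uIcc_subset_Icc hs ht h))
  simpa using this

/-- If `u ≤ 1` almost everywhere on `[0, τ]` and `∫ u = τ`, then `u = 1` almost everywhere. -/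
theorem ae_eq_one_of_integral_eq {τ : ℝ} (hτ : 0 ≤ τ) {u : ℝ → ℝ}
    (hu : IntervalIntegrable u volume 0 τ)
    (hbound : ∀ᵐ t ∂volume, t ∈ Set.Icc 0 τ → u t ≤ 1)
    (hint : ∫ t in (0:ℝ)..τ, u t = τ) :
    ∀ᵐ t ∂volume, t ∈ Set.Icc 0 τ → u t = 1 := by
  have h0 : ∫ t in (0:ℝ)..τ, (1 - u t) = 0 := by
    rw [intervalIntegral.integral_sub intervalIntegrable_const hu, hint]
    simp
  have hnn : 0 ≤ᵐ[volume.restrict (Set.Ioc 0 τ)] fun t => 1 - u t := by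
    refine (ae_restrict_iff' measurableSet_Ioc).2 ?_
    filter_upwards [hbound] with t ht hmem
    exact sub_nonneg.2 (ht (Set.Ioc_subset_Icc_self hmem))
  have hz := (intervalIntegral.integral_eq_zero_iff_of_le_of_nonneg_ae hτ hnn
    (intervalIntegrable_const.sub hu)).1 h0
  rw [restrict_Ioc_eq_restrict_Icc, Filter.EventuallyEq, ae_restrict_iff' measurableSet_Icc] at hz
  filter_upwards [hz] with t ht hmem
  have := ht hmem
  simp only [Pi.zero_apply] at this
  linarith

/-- Bending away from zero makes the weighted integral strictly smaller than `τ`. -/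
theorem integral_mul_one_sub_lt {p : ℕ} (hpe : Even p) {τ : ℝ}
    (hτ' : τ < 2 / ((p : ℝ) + 1)) {u x : ℝ → ℝ}
    (hu : IntervalIntegrable u volume 0 τ)
    (hbound : ∀ᵐ t ∂volume, t ∈ Set.Icc 0 τ → |u t| ≤ 1)
    (hx : ∀ s ∈ Set.Icc 0 τ, ∀ t ∈ Set.Icc 0 τ, |x t - x s| ≤ |t - s|)
    (hcont : ContinuousOn x (Set.Icc 0 τ)) (h0 : x 0 = 0) (hend : x τ = 0)
    (hzero : ∫ t in (0:ℝ)..τ, u t * x t ^ p = 0)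
    (hne : ∃ t ∈ Set.Icc 0 τ, x t ≠ 0) :
    ∫ t in (0:ℝ)..τ, u t * (1 - x t) < τ := by
  obtain ⟨d, hd, hxd⟩ := hne
  have hτ : 0 ≤ τ := hd.1.trans hd.2
  obtain ⟨c, hc, hmax⟩ := isCompact_Icc.exists_isMaxOn ⟨d, hd⟩ hcont.abs
  have hmax : ∀ t ∈ Set.Icc 0 τ, |x t| ≤ |x c| := fun t ht => hmax ht
  have htent := two_mul_abs_pow_div_le_integral_abs_pow p hx hcont h0 hend hc
  set b := |x c| with hb
  have hbpos : 0 < b := (abs_pos.2 hxd).trans_le (hmax d hd)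
  have hcontu : ContinuousOn x (Set.uIcc 0 τ) := by rwa [Set.uIcc_of_le hτ]
  have hxint : IntervalIntegrable (fun t => x t ^ p) volume 0 τ :=
    (hcontu.pow p).intervalIntegrable
  have huxp : IntervalIntegrable (fun t => u t * x t ^ p) volume 0 τ :=
    hu.mul_continuousOn (hcontu.pow p)
  have hux : IntervalIntegrable (fun t => u t * x t) volume 0 τ := hu.mul_continuousOn hcontu
  have h1u : IntervalIntegrable (fun t => 1 - u t) volume 0 τ := intervalIntegrable_const.sub hu
  have hloss : ∫ t in (0:ℝ)..τ, |x t| ^ p ≤ b ^ p * ∫ t in (0:ℝ)..τ, (1 - u t) := by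
    calc ∫ t in (0:ℝ)..τ, |x t| ^ p = ∫ t in (0:ℝ)..τ, (x t ^ p - u t * x t ^ p) := by
          rw [intervalIntegral.integral_sub hxint huxp, hzero, sub_zero]
          simp only [hpe.pow_abs]
      _ ≤ ∫ t in (0:ℝ)..τ, b ^ p * (1 - u t) := by
          refine intervalIntegral.integral_mono_ae_restrict hτ (hxint.sub huxp)
            (h1u.const_mul _) ?_
          refine (ae_restrict_iff' measurableSet_Icc).2 ?_
          filter_upwards [hbound] with t ht hmem
          have h1 : x t ^ p ≤ b ^ p := by
            rw [← hpe.pow_abs (x t)]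
            exact pow_le_pow_left₀ (abs_nonneg _) (hmax t hmem) p
          nlinarith [(abs_le.1 (ht hmem)).2]
      _ = _ := intervalIntegral.integral_const_mul _ _
  have hL : 2 * b / ((p : ℝ) + 1) ≤ ∫ t in (0:ℝ)..τ, (1 - u t) := by
    refine le_of_mul_le_mul_left ?_ (pow_pos hbpos p)
    calc b ^ p * (2 * b / ((p : ℝ) + 1)) = 2 * b ^ (p + 1) / ((p : ℝ) + 1) := by ring
      _ ≤ _ := htent.trans hloss
  have hgain : |∫ t in (0:ℝ)..τ, u t * x t| ≤ b * τ := by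
    have := intervalIntegral.norm_integral_le_of_norm_le_const_ae (a := 0) (b := τ) (C := b)
      (f := fun t => u t * x t) (by
        filter_upwards [hbound] with t ht hmem
        rw [Set.uIoc_of_le hτ] at hmem
        have hmem := Set.Ioc_subset_Icc_self hmem
        rw [Real.norm_eq_abs, abs_mul]
        simpa using mul_le_mul (ht hmem) (hmax t hmem) (abs_nonneg _) zero_le_one)
    simpa [abs_of_nonneg hτ] using this
  have hsplit : ∫ t in (0:ℝ)..τ, u t * (1 - x t)
      = τ - (∫ t in (0:ℝ)..τ, (1 - u t)) - ∫ t in (0:ℝ)..τ, u t * x t := by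
    simp only [mul_sub, mul_one]
    rw [intervalIntegral.integral_sub hu hux,
      intervalIntegral.integral_sub intervalIntegrable_const hu]
    simp
  have hstrict : b * τ < 2 * b / ((p : ℝ) + 1) := by
    calc b * τ < b * (2 / ((p : ℝ) + 1)) := mul_lt_mul_of_pos_left hτ' hbpos
      _ = _ := by ring
  rw [hsplit]
  linarith [(abs_le.1 hgain).1]

/-- the key minimality inequality for the example with even `p`:
under the stated horizontality, arc-length and return conditions,
`∫₀^τ u₂(1−η₁) ≤ τ` with equality iff `u₁ = 0`, `u₂ = 1` a.e. -/
theorem minimality_inequality_even_p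
    (p : ℕ) (hp2 : 2 ≤ p) (hpe : Even p) (τ a : ℝ) (hτ : 0 < τ)
    (hτ' : τ < 2 / ((p : ℝ) + 1))
    (u1 u2 η1 η2 η3 : ℝ → ℝ)
    (hu1int : IntervalIntegrable u1 volume 0 τ)
    (hu2int : IntervalIntegrable u2 volume 0 τ)
    (hnorm : ∀ᵐ t ∂volume, t ∈ Set.Icc 0 τ → u1 t ^ 2 + u2 t ^ 2 = 1)
    (hη1 : ∀ t, η1 t = ∫ s in (0:ℝ)..t, u1 s)
    (hη2 : ∀ t, η2 t = a + ∫ s in (0:ℝ)..t, u2 s * (1 - η1 s))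
    (hη3 : ∀ t, η3 t = ∫ s in (0:ℝ)..t, u2 s * η1 s ^ p)
    (hend1 : η1 τ = 0) (hend3 : η3 τ = 0) :
    (∫ t in (0:ℝ)..τ, u2 t * (1 - η1 t)) ≤ τ ∧
    ((∫ t in (0:ℝ)..τ, u2 t * (1 - η1 t)) = τ ↔
      ∀ᵐ t ∂volume, t ∈ Set.Icc 0 τ → u1 t = 0 ∧ u2 t = 1) := by
  have hb1 : ∀ᵐ t ∂volume, t ∈ Set.Icc 0 τ → |u1 t| ≤ 1 := by
    filter_upwards [hnorm] with t ht hmem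
    exact abs_le_one_iff_mul_self_le_one.2 (by nlinarith [ht hmem, sq_nonneg (u2 t)])
  have hb2 : ∀ᵐ t ∂volume, t ∈ Set.Icc 0 τ → |u2 t| ≤ 1 := by
    filter_upwards [hnorm] with t ht hmem
    exact abs_le_one_iff_mul_self_le_one.2 (by nlinarith [ht hmem, sq_nonneg (u1 t)])
  have hlip : ∀ s ∈ Set.Icc 0 τ, ∀ t ∈ Set.Icc 0 τ, |η1 t - η1 s| ≤ |t - s| := by
    intro s hs t ht
    rw [hη1, hη1]
    exact abs_primitive_sub_le hτ.le hu1int hb1 hs ht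
  have hcont : ContinuousOn η1 (Set.Icc 0 τ) :=
    (LipschitzOnWith.of_dist_le_mul (K := 1) fun t ht s hs => by
      simpa [Real.dist_eq] using hlip s hs t ht).continuousOn
  have h0 : η1 0 = 0 := by simp [hη1]
  by_cases hne : ∃ t ∈ Set.Icc 0 τ, η1 t ≠ 0
  · have hlt := integral_mul_one_sub_lt hpe hτ' hu2int hb2 hlip hcont h0 hend1
      ((hη3 τ).symm.trans hend3) hne
    refine ⟨hlt.le, fun h => absurd h hlt.ne, fun h => ?_⟩
    obtain ⟨t, ht, hxt⟩ := hne
    refine absurd ?_ hxt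
    rw [hη1]
    refine intervalIntegral.integral_zero_ae ?_
    filter_upwards [h] with s hs hmem
    rw [Set.uIoc_of_le ht.1] at hmem
    exact (hs ⟨hmem.1.le, hmem.2.trans ht.2⟩).1
  · push Not at hne
    have heq : ∫ t in (0:ℝ)..τ, u2 t * (1 - η1 t) = ∫ t in (0:ℝ)..τ, u2 t := by
      refine intervalIntegral.integral_congr fun t ht => ?_
      rw [Set.uIcc_of_le hτ.le] at ht
      simp [hne t ht]
    rw [heq]
    have hb2' : ∀ᵐ t ∂volume, t ∈ Set.Icc 0 τ → u2 t ≤ 1 := by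
      filter_upwards [hb2] with t ht hmem using (abs_le.1 (ht hmem)).2
    refine ⟨?_, fun h => ?_, fun h => ?_⟩
    · calc ∫ t in (0:ℝ)..τ, u2 t ≤ ∫ _ in (0:ℝ)..τ, (1 : ℝ) :=
            intervalIntegral.integral_mono_ae_restrict hτ.le hu2int intervalIntegrable_const
              ((ae_restrict_iff' measurableSet_Icc).2 hb2')
        _ = τ := by simp
    · filter_upwards [ae_eq_one_of_integral_eq hτ.le hu2int hb2' h, hnorm] with t h2 hn hmem
      have h2 := h2 hmem
      have hn := hn hmem
      rw [h2] at hn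
      exact ⟨pow_eq_zero_iff two_ne_zero |>.1 (by linarith), h2⟩
    · calc ∫ t in (0:ℝ)..τ, u2 t = ∫ _ in (0:ℝ)..τ, (1 : ℝ) := by
            refine intervalIntegral.integral_congr_ae ?_
            filter_upwards [h] with t ht hmem
            rw [Set.uIoc_of_le hτ.le] at hmem
            exact (ht (Set.Ioc_subset_Icc_self hmem)).2
        _ = τ := by simp
end
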